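/- Let Q : (-1,1) → ℝ be four-times continuously differentiable and γ : (-1,1) → ℝ be twice continuously differentiable, and suppose that for all x ∈ (-1,1): (i) ((1-x²)γ(x))' - (1-x²)Q''(x) + 2Q(x) = 0, and (ii) (1-x²)·((1-x²)γ(x))'' + 2x·((1-x²)γ(x))' + 2(1-x²)γ(x) + 4(1-x²)Q'(x) + 8xQ(x) = 0. If moreover Q' and γ are bounded on (-1,1), then there exists a constant K such that Q(x) = K·x·(1-x²) and γ(x) = 2K·(1-x²) for all x ∈ (-1,1). -/

import Mathlib

lemma aux_const (f : ℝ → ℝ) (h : ∀ x ∈ Set.Ioo (-1 : ℝ) 1, HasDerivAt f 0 x) :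
    ∀ x ∈ Set.Ioo (-1 : ℝ) 1, f x = f 0 := by
  intro x hx
  refine isOpen_Ioo.is_const_of_deriv_eq_zero isPreconnected_Ioo
    (fun y hy => (h y hy).differentiableAt.differentiableWithinAt)
    (fun y hy => (h y hy).deriv) hx (by norm_num)

lemma aux_mono (f f' : ℝ → ℝ) (h : ∀ x ∈ Set.Ico (1/2 : ℝ) 1, HasDerivAt f (f' x) x)
    (h0 : ∀ x ∈ Set.Ico (1/2 : ℝ) 1, 0 ≤ f' x) :
    ∀ x ∈ Set.Ico (1/2 : ℝ) 1, f (1/2) ≤ f x := by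
  intro x hx
  have : MonotoneOn f (Set.Ico (1/2 : ℝ) 1) := by
    apply monotoneOn_of_deriv_nonneg (convex_Ico _ _)
    · exact fun y hy => (h y hy).continuousAt.continuousWithinAt
    · exact fun y hy => (h y (interior_subset hy)).differentiableAt.differentiableWithinAt
    · intro y hy
      rw [(h y (interior_subset hy)).deriv]
      exact h0 y (interior_subset hy)
  exact this (by norm_num) hx hx.1

lemma aux_C (P P1 P2 : ℝ → ℝ) (C M : ℝ)
    (h1 : ∀ x ∈ Set.Ioo (-1 : ℝ) 1, HasDerivAt P (P1 x) x)
    (h2 : ∀ x ∈ Set.Ioo (-1 : ℝ) 1, HasDerivAt P1 (P2 x) x)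
    (hC : ∀ x ∈ Set.Ioo (-1 : ℝ) 1, (1 - x^2)^2 * (x * P2 x - P1 x) = C)
    (hM : ∀ x ∈ Set.Ioo (-1 : ℝ) 1, |P x| ≤ M) : C ≤ 0 := by
  by_contra! hpos
  have hI : ∀ x ∈ Set.Ico (1/2 : ℝ) 1, x ∈ Set.Ioo (-1 : ℝ) 1 :=
    fun x hx => ⟨by linarith [hx.1], hx.2⟩
  have hw : ∀ x ∈ Set.Ico (1/2 : ℝ) 1, 0 < 1 - x^2 := by
    intro x hx
    nlinarith [hx.1, hx.2]
  have hA := aux_mono (fun x => x * P1 x - 2 * P x - C / 2 * (x / (1 - x^2)))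
    (fun x => (x * P2 x - P1 x) - C / 2 * ((1 + x^2) / (1 - x^2)^2))
    (by
      intro x hx
      have hne := (hw x hx).ne'
      have d := (((hasDerivAt_id' x).fun_mul (h2 x (hI x hx))).fun_sub ((h1 x (hI x hx)).const_mul 2)).fun_sub
        (((hasDerivAt_id' x).fun_div (((hasDerivAt_id' x).fun_pow 2).const_sub 1) hne).const_mul (C/2))
      refine HasDerivAt.congr_deriv d ?_
      simp
      field_simp
      ring)
    (by
      intro x hx
      have hp := hw x hx
      have e : x * P2 x - P1 x = C / (1 - x^2)^2 := by
        rw [eq_div_iff (by positivity), ← hC x (hI x hx)]; ring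
      have : (x * P2 x - P1 x) - C / 2 * ((1 + x^2) / (1 - x^2)^2)
          = C / 2 * (1 - x^2) / (1 - x^2)^2 := by
        rw [e]; field_simp; ring
      simp only [this]
      positivity)
  set A := (fun x => x * P1 x - 2 * P x - C / 2 * (x / (1 - x^2))) (1/2) with hAdef
  clear_value A
  have hM0 : 0 ≤ M := (abs_nonneg _).trans (hM 0 (by norm_num))
  set B := 2 * (2 * M + |A|) with hB
  have hP1 : ∀ x ∈ Set.Ico (1/2 : ℝ) 1, C / (4 * (1 - x)) - B ≤ P1 x := by
    intro x hx
    have hp := hw x hx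
    have a := hA x hx
    beta_reduce at a
    have m := abs_le.1 (hM x (hI x hx))
    have a2 := neg_abs_le A
    have x1 : 0 < 1 - x := by linarith [hx.2]
    have x0 : 0 < x := by linarith [hx.1]
    have k1 : C / (4 * (1 - x)) ≤ C / 2 * (1 / (1 - x^2)) := by
      rw [div_mul_div_comm, mul_one]
      apply div_le_div_of_nonneg_left hpos.le (by positivity)
      nlinarith
    have k2 : x * (C / (4 * (1 - x))) ≤ C / 2 * (x / (1 - x^2)) := by
      calc _ ≤ x * (C / 2 * (1 / (1 - x^2))) := by gcongr
        _ = _ := by ring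
    have k3 : x * (C / (4 * (1 - x)) - B) ≤ x * P1 x := by
      have : 2 * M + |A| ≤ x * B := by
        rw [hB]; nlinarith [hx.1, abs_nonneg A]
      nlinarith
    exact le_of_mul_le_mul_left k3 x0
  have hL := aux_mono (fun x => P x + C / 4 * Real.log (1 - x) + B * x)
    (fun x => P1 x - C / (4 * (1 - x)) + B)
    (by
      intro x hx
      have x1 : 1 - x ≠ 0 := by linarith [hx.2]
      have d := ((h1 x (hI x hx)).fun_add
        ((((hasDerivAt_id' x).const_sub 1).log x1).const_mul (C/4))).fun_add
        ((hasDerivAt_id' x).const_mul B)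
      refine HasDerivAt.congr_deriv d ?_
      simp
      field_simp
      ring)
    (by intro x hx; linarith [hP1 x hx])
  set E := (fun x => P x + C / 4 * Real.log (1 - x) + B * x) (1/2) with hE
  clear_value E
  set t := max 1 (4 / C * (M + B - E) + 1) with ht
  have t1 : 1 ≤ t := le_max_left _ _
  have t2 : 4 / C * (M + B - E) + 1 ≤ t := le_max_right _ _
  have ex : Real.exp (-t) ≤ 1/2 := by
    rw [Real.exp_neg, one_div]
    apply inv_anti₀ (by norm_num)
    linarith [Real.add_one_le_exp t]
  have hx : 1 - Real.exp (-t) ∈ Set.Ico (1/2 : ℝ) 1 :=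
    ⟨by linarith, by linarith [Real.exp_pos (-t)]⟩
  have l := hL _ hx
  have m := abs_le.1 (hM _ (hI _ hx))
  have hB0 : 0 ≤ B := by positivity
  simp only [sub_sub_cancel, Real.log_exp] at l
  have l3 : B * (1 - Real.exp (-t)) ≤ B := by nlinarith [Real.exp_pos (-t)]
  have l4 : C / 4 * t ≤ M + B - E := by linarith
  have l5 : C / 4 * (4 / C * (M + B - E) + 1) ≤ C / 4 * t := by gcongr
  have l6 : C / 4 * (4 / C * (M + B - E) + 1) = (M + B - E) + C / 4 := by field_simp
  linarith

/-- The coupled gauge-invariant system for `(γ_xφ^(1), Q₁)` on `(-1,1)`: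
if `Q` is C⁴, `γ` is C², both equations hold on `(-1,1)`, and `Q'` and `γ` are bounded,
then `Q(x) = K x (1-x²)` and `γ(x) = 2K(1-x²)` for some constant `K`. -/
theorem ads2s2_coupled_system_solution (Q γ : ℝ → ℝ)
    (hQdiff : ∀ k ≤ 3, ∀ x ∈ Set.Ioo (-1 : ℝ) 1, DifferentiableAt ℝ (iteratedDeriv k Q) x)
    (hQcont : ContinuousOn (iteratedDeriv 4 Q) (Set.Ioo (-1 : ℝ) 1))
    (hγdiff : ∀ k ≤ 1, ∀ x ∈ Set.Ioo (-1 : ℝ) 1, DifferentiableAt ℝ (iteratedDeriv k γ) x)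
    (hγcont : ContinuousOn (iteratedDeriv 2 γ) (Set.Ioo (-1 : ℝ) 1))
    (heq1 : ∀ x ∈ Set.Ioo (-1 : ℝ) 1,
      deriv (fun y => (1 - y^2) * γ y) x - (1 - x^2) * iteratedDeriv 2 Q x + 2 * Q x = 0)
    (heq2 : ∀ x ∈ Set.Ioo (-1 : ℝ) 1,
      (1 - x^2) * iteratedDeriv 2 (fun y => (1 - y^2) * γ y) x
        + 2 * x * deriv (fun y => (1 - y^2) * γ y) x
        + 2 * (1 - x^2) * γ x + 4 * (1 - x^2) * deriv Q x + 8 * x * Q x = 0)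
    (hbdd : ∃ M : ℝ, ∀ x ∈ Set.Ioo (-1 : ℝ) 1, |deriv Q x| ≤ M ∧ |γ x| ≤ M) :
    ∃ K : ℝ, ∀ x ∈ Set.Ioo (-1 : ℝ) 1,
      Q x = K * x * (1 - x^2) ∧ γ x = 2 * K * (1 - x^2) := by

  obtain ⟨M, hM⟩ := hbdd
  have d0 : ∀ x ∈ Set.Ioo (-1 : ℝ) 1, HasDerivAt Q (deriv Q x) x := by
    intro x hx
    have := (hQdiff 0 (by norm_num) x hx)
    rw [iteratedDeriv_zero] at this
    exact this.hasDerivAt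
  have dd : ∀ k ≤ 3, ∀ x ∈ Set.Ioo (-1 : ℝ) 1,
      HasDerivAt (iteratedDeriv k Q) (iteratedDeriv (k+1) Q x) x := by
    intro k hk x hx
    rw [iteratedDeriv_succ]
    exact (hQdiff k hk x hx).hasDerivAt
  have d1 := dd 1 (by norm_num)
  have d2 := dd 2 (by norm_num)
  have d3 := dd 3 (by norm_num)
  rw [iteratedDeriv_one] at d1
  norm_num at d1 d2 d3
  have dw : ∀ x : ℝ, HasDerivAt (fun y : ℝ => 1 - y^2) (-(2*x)) x := by
    intro x
    simpa using ((hasDerivAt_id' x).fun_pow 2).const_sub 1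
  have hg : ∀ x ∈ Set.Ioo (-1 : ℝ) 1, HasDerivAt (fun y => (1 - y^2) * γ y)
      ((1 - x^2) * iteratedDeriv 2 Q x - 2 * Q x) x := by
    intro x hx
    have := (hγdiff 0 (by norm_num) x hx)
    rw [iteratedDeriv_zero] at this
    have h := ((dw x).differentiableAt.fun_mul this).hasDerivAt
    refine HasDerivAt.congr_deriv h ?_
    linarith [heq1 x hx]
  have hg2 : ∀ x ∈ Set.Ioo (-1 : ℝ) 1, iteratedDeriv 2 (fun y => (1 - y^2) * γ y) x =
      (1 - x^2) * iteratedDeriv 3 Q x - 2 * x * iteratedDeriv 2 Q x - 2 * deriv Q x := by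
    intro x hx
    rw [iteratedDeriv_succ, iteratedDeriv_one]
    have e : deriv (fun y => (1 - y^2) * γ y) =ᶠ[nhds x]
        fun y => (1 - y^2) * iteratedDeriv 2 Q y - 2 * Q y := by
      filter_upwards [isOpen_Ioo.mem_nhds hx] with y hy using (hg y hy).deriv
    rw [e.deriv_eq]
    have h := ((dw x).fun_mul (d2 x hx.1 hx.2)).fun_sub ((d0 x hx).const_mul 2)
    rw [h.deriv]; ring
  have key : ∀ x ∈ Set.Ioo (-1 : ℝ) 1, (1 - x^2) * γ x =
      -((1 - x^2)^2 * iteratedDeriv 3 Q x + 2 * (1 - x^2) * deriv Q x + 4 * x * Q x) / 2 := by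
    intro x hx
    have h := heq2 x hx
    rw [hg2 x hx, (hg x hx).deriv] at h
    linarith
  have ode : ∀ x ∈ Set.Ioo (-1 : ℝ) 1, (1 - x^2) * iteratedDeriv 4 Q x
      - 4 * x * iteratedDeriv 3 Q x + 4 * iteratedDeriv 2 Q x = 0 := by
    intro x hx
    have h := ((((((dw x).fun_pow 2).fun_mul (d3 x hx.1 hx.2)).fun_add
      (((dw x).const_mul 2).fun_mul (d1 x hx.1 hx.2))).fun_add
      (((hasDerivAt_id' x).const_mul 4).fun_mul (d0 x hx))).fun_neg).div_const 2
    have e : (fun y => (1 - y^2) * γ y) =ᶠ[nhds x] fun y => -((1 - y^2)^2 * iteratedDeriv 3 Q y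
        + 2 * (1 - y^2) * deriv Q y + 4 * y * Q y) / 2 := by
      filter_upwards [isOpen_Ioo.mem_nhds hx] with y hy using key y hy
    have u := (hg x hx).unique (h.congr_of_eventuallyEq e)
    have hw : 0 < 1 - x^2 := by nlinarith [hx.1, hx.2]
    apply mul_left_cancel₀ hw.ne'
    norm_num at u
    linarith
  have hconst := aux_const
    (fun x => (1 - x^2)^2 * (x * iteratedDeriv 3 Q x - iteratedDeriv 2 Q x)) (by
      intro x hx
      have h := ((dw x).fun_pow 2).fun_mul
        (((hasDerivAt_id' x).fun_mul (d3 x hx.1 hx.2)).fun_sub (d2 x hx.1 hx.2))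
      refine HasDerivAt.congr_deriv h ?_
      norm_num
      linear_combination (x * (1 - x^2)) * ode x hx)
  beta_reduce at hconst
  have c1 := aux_C (deriv Q) _ _ _ M (fun x hx => d1 x hx.1 hx.2) (fun x hx => d2 x hx.1 hx.2)
    hconst (fun x hx => (hM x hx).1)
  have c2 := aux_C (fun x => - deriv Q x) (fun x => - iteratedDeriv 2 Q x)
    (fun x => - iteratedDeriv 3 Q x)
    (-((1 - 0 ^ 2) ^ 2 * (0 * iteratedDeriv 3 Q 0 - iteratedDeriv 2 Q 0))) M (fun x hx => (d1 x hx.1 hx.2).fun_neg)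
    (fun x hx => (d2 x hx.1 hx.2).fun_neg)
    (fun x hx => by
      have := hconst x hx
      linear_combination -this) (fun x hx => by rw [abs_neg]; exact (hM x hx).1)
  have c0 := le_antisymm c1 (by linarith)
  have hu : ∀ x ∈ Set.Ioo (-1 : ℝ) 1, iteratedDeriv 2 Q x = x * iteratedDeriv 3 Q x := by
    intro x hx
    have h := (hconst x hx).trans c0
    have hw : 0 < 1 - x^2 := by nlinarith [hx.1, hx.2]
    rcases mul_eq_zero.1 h with h | h
    · exact absurd h (by positivity)
    · linarith
  have h3 := aux_const (iteratedDeriv 3 Q) (by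
    intro x hx
    have hw : 0 < 1 - x^2 := by nlinarith [hx.1, hx.2]
    have : iteratedDeriv 4 Q x = 0 := by
      apply mul_left_cancel₀ hw.ne'
      have := ode x hx
      rw [hu x hx] at this
      linarith
    rw [← this]; exact d3 x hx.1 hx.2)
  set a := iteratedDeriv 3 Q 0 with ha
  clear_value a
  have h1 := aux_const (fun x => deriv Q x - a / 2 * x^2) (by
    intro x hx
    have h := (d1 x hx.1 hx.2).fun_sub (((hasDerivAt_id' x).fun_pow 2).const_mul (a/2))
    refine HasDerivAt.congr_deriv h ?_
    rw [hu x hx, h3 x hx]; norm_num; ring)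
  beta_reduce at h1
  set b := deriv Q 0 - a / 2 * 0^2 with hb
  clear_value b
  have h0 := aux_const (fun x => Q x - a / 6 * x^3 - b * x) (by
    intro x hx
    have h := ((d0 x hx).fun_sub (((hasDerivAt_id' x).fun_pow 3).const_mul (a/6))).fun_sub
      ((hasDerivAt_id' x).const_mul b)
    refine HasDerivAt.congr_deriv h ?_
    norm_num
    linarith [h1 x hx])
  beta_reduce at h0
  set c := Q 0 - a / 6 * 0^3 - b * 0 with hc
  clear_value c
  have key2 : ∀ x ∈ Set.Ioo (-1 : ℝ) 1, (1 - x^2) * γ x =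
      -((1 - x^2)^2 * a + 2 * (1 - x^2) * (a/2*x^2 + b) + 4 * x * (a/6*x^3+b*x+c)) / 2 := by
    intro x hx
    rw [key x hx, h3 x hx, show deriv Q x = a/2*x^2 + b by linarith [h1 x hx],
      show Q x = a/6*x^3+b*x+c by linarith [h0 x hx]]
  have bd : ∀ x ∈ Set.Icc (-1 : ℝ) 1,
      |-((1 - x^2)^2 * a + 2 * (1 - x^2) * (a/2*x^2 + b) + 4 * x * (a/6*x^3+b*x+c)) / 2|
        ≤ (1 - x^2) * M := by
    have hcl : IsClosed {x : ℝ | |-((1 - x^2)^2 * a + 2 * (1 - x^2) * (a/2*x^2 + b)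
        + 4 * x * (a/6*x^3+b*x+c)) / 2| ≤ (1 - x^2) * M} :=
      isClosed_le (by fun_prop) (by fun_prop)
    rw [← closure_Ioo (by norm_num : (-1 : ℝ) ≠ 1)]
    refine closure_minimal ?_ hcl
    intro x hx
    have hw : 0 < 1 - x^2 := by nlinarith [hx.1, hx.2]
    change |-((1 - x^2)^2 * a + 2 * (1 - x^2) * (a/2*x^2 + b)
        + 4 * x * (a/6*x^3+b*x+c)) / 2| ≤ (1 - x^2) * M
    rw [← key2 x hx, abs_mul, abs_of_pos hw]
    exact mul_le_mul_of_nonneg_left (hM x hx).2 hw.le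
  have b1 := bd 1 (by norm_num)
  have b2 := bd (-1) (by norm_num)
  norm_num at b1 b2
  have hc0 : c = 0 := by linarith
  have hb0 : b = -a/6 := by linarith
  refine ⟨-a/6, fun x hx => ⟨?_, ?_⟩⟩
  · have := h0 x hx
    rw [hc0, hb0] at this
    linarith
  · have hw : 0 < 1 - x^2 := by nlinarith [hx.1, hx.2]
    apply mul_left_cancel₀ hw.ne'
    rw [key2 x hx, hc0, hb0]; ring
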